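/- Let n ≥ 3 be an odd integer with 3 ∣ n. Then in the dicyclic group Dic_{4n}: the number of MSTD subsets of cardinality 3 is S_{Dic_{4n}}(3) = 4n(n−1)(2n−5), the number of MDTS subsets of cardinality 3 is D_{Dic_{4n}}(3) = 2n(2n²+3n−3)/3, and the number of balanced subsets of cardinality 3 is B_{Dic_{4n}}(3) = 2n(2n²+27n−25)/3. -/

import Mathlib

open Finset Pointwise

/-- A finset of a group is MSTD if its sumset `A * A` is larger than its
difference set `A / A = {a₁ * a₂⁻¹}`. -/
def IsMSTD {G : Type*} [Group G] [DecidableEq G] (A : Finset G) : Prop :=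
  (A / A).card < (A * A).card

/-- A finset of a group is MDTS if its sumset is smaller than its difference set. -/
def IsMDTS {G : Type*} [Group G] [DecidableEq G] (A : Finset G) : Prop :=
  (A * A).card < (A / A).card

/-- A finset of a group is balanced if its sumset and difference set have equal size. -/
def IsBalanced {G : Type*} [Group G] [DecidableEq G] (A : Finset G) : Prop :=
  (A * A).card = (A / A).card

namespace QuaternionGroup

variable {n : ℕ}

theorem two_mul_natCast_self : (n : ZMod (2 * n)) + n = 0 := by
  rw [← two_mul]; exact_mod_cast ZMod.natCast_self (2 * n)

theorem add_self_ne_natCast (hodd : Odd n) (x : ZMod (2 * n)) : x + x ≠ n := by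
  intro h
  have h' := congrArg (ZMod.castHom (dvd_mul_right 2 n) (ZMod 2)) h
  rw [map_add, map_natCast, CharTwo.add_self_eq_zero] at h'
  exact Nat.not_even_iff_odd.mpr hodd ((ZMod.natCast_eq_zero_iff_even).mp h'.symm)

theorem eq_zero_or_eq_natCast_of_add_self_eq_zero (hn : n ≠ 0) {x : ZMod (2 * n)}
    (h : x + x = 0) : x = 0 ∨ x = n := by
  have : NeZero n := ⟨hn⟩
  have hlt := x.val_lt
  rw [← ZMod.natCast_zmod_val x] at h ⊢
  rw [← two_mul] at h
  have h' : ((2 * x.val : ℕ) : ZMod (2 * n)) = 0 := by exact_mod_cast h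
  rw [ZMod.natCast_eq_zero_iff] at h'
  obtain ⟨c, hc⟩ := Nat.dvd_of_mul_dvd_mul_left two_pos h'
  rw [hc] at hlt ⊢
  have : c < 2 := by nlinarith
  interval_cases c <;> simp

theorem card_filter_three_mul_eq_zero (hdvd : 3 ∣ n) [NeZero n] :
    #{x : ZMod (2 * n) | 3 * x = 0} = 3 := by
  obtain ⟨m, rfl⟩ := hdvd
  have hm : 0 < m := by have := NeZero.ne (3 * m); omega
  have key : ({x : ZMod (2 * (3 * m)) | 3 * x = 0} : Finset _) =
      (range 3).image fun c : ℕ => ((2 * m * c : ℕ) : ZMod (2 * (3 * m))) := by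
    ext x
    simp only [mem_filter, mem_univ, true_and, mem_image, mem_range]
    constructor
    · intro h
      have hlt := x.val_lt
      rw [← ZMod.natCast_zmod_val x] at h
      have h' : ((3 * x.val : ℕ) : ZMod (2 * (3 * m))) = 0 := by exact_mod_cast h
      rw [ZMod.natCast_eq_zero_iff] at h'
      replace h' : 3 * (2 * m) ∣ 3 * x.val := by rwa [mul_left_comm]
      obtain ⟨c, hc⟩ := Nat.dvd_of_mul_dvd_mul_left three_pos h'
      refine ⟨c, by nlinarith, ?_⟩
      rw [← hc, ZMod.natCast_zmod_val]
    · rintro ⟨c, -, rfl⟩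
      have : ((3 * (2 * m * c) : ℕ) : ZMod (2 * (3 * m))) = 0 := by
        rw [ZMod.natCast_eq_zero_iff]
        exact ⟨c, by ring⟩
      exact_mod_cast this
  rw [key, card_image_of_injOn, card_range]
  intro c hc d hd h
  simp only [coe_range, Set.mem_Iio] at hc hd
  have h' := (ZMod.natCast_eq_natCast_iff' _ _ _).mp h
  rw [Nat.mod_eq_of_lt (by nlinarith), Nat.mod_eq_of_lt (by nlinarith)] at h'
  exact Nat.eq_of_mul_eq_mul_left (by omega) h'

theorem card_image_a_union_image_xa (s t : Finset (ZMod (2 * n))) :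
    #(s.image a ∪ t.image xa) = #s + #t := by
  rw [card_union_of_disjoint, card_image_of_injective _ fun _ _ => a.inj,
    card_image_of_injective _ fun _ _ => xa.inj]
  simp [disjoint_left]

theorem inv_a (i : ZMod (2 * n)) : (a i)⁻¹ = a (-i) := rfl

theorem inv_xa (i : ZMod (2 * n)) : (xa i)⁻¹ = xa ((n : ZMod (2 * n)) + i) := rfl

theorem a_div_a (i j : ZMod (2 * n)) : a i / a j = a (i - j) := by
  simp [div_eq_mul_inv, inv_a, sub_eq_add_neg]

theorem xa_div_a (i j : ZMod (2 * n)) : xa i / a j = xa (i - j) := by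
  simp [div_eq_mul_inv, inv_a, sub_eq_add_neg]

theorem a_div_xa (i j : ZMod (2 * n)) : a i / xa j = xa ((n : ZMod (2 * n)) + j - i) := by
  simp [div_eq_mul_inv, inv_xa]

theorem xa_div_xa (i j : ZMod (2 * n)) : xa i / xa j = a (j - i) := by
  simp only [div_eq_mul_inv, inv_xa, xa_mul_xa, ← add_assoc, two_mul_natCast_self, zero_add]

theorem card_insert_of_card {α : Type*} [DecidableEq α] {x : α} {s : Finset α} {m : ℕ}
    (h : x ∉ s) (hs : #s = m) : #(insert x s) = m + 1 := by
  rw [card_insert_of_notMem h, hs]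

theorem card_triple {α : Type*} [DecidableEq α] {x y z : α} (h : x ≠ y) (h' : x ≠ z) (h'' : y ≠ z) :
    #{x, y, z} = 3 := card_eq_three.mpr ⟨x, y, z, h, h', h'', rfl⟩

theorem card_quadruple {α : Type*} [DecidableEq α] {x y z w : α} (h : x ≠ y) (h' : x ≠ z)
    (h'' : x ≠ w) (h1 : #{y, z, w} = 3) : #{x, y, z, w} = 4 :=
  card_insert_of_card (by simp [*]) h1

theorem card_mul_aax (i j k : ZMod (2 * n)) :
    #(({a i, a j, xa k} : Finset (QuaternionGroup n)) * {a i, a j, xa k}) =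
      #{i + i, j + j, i + j, (n : ZMod (2 * n))} + #{k - i, k - j, k + i, k + j} := by
  rw [← card_image_a_union_image_xa]
  congr 1
  ext (x | x) <;> simp [mem_mul, eq_comm, add_comm j i] <;> tauto

theorem card_div_aax (i j k : ZMod (2 * n)) :
    #(({a i, a j, xa k} : Finset (QuaternionGroup n)) / {a i, a j, xa k}) =
      #{0, i - j, j - i} + #{k - i, k - j, n + k - i, n + k - j} := by
  have := two_mul_natCast_self (n := n)
  rw [← card_image_a_union_image_xa]
  congr 1
  ext (x | x) <;> simp [mem_div, a_div_a, a_div_xa, xa_div_a, one_def, eq_comm, -a_zero] <;> grind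

theorem card_mul_axx (i j k : ZMod (2 * n)) :
    #(({a i, xa j, xa k} : Finset (QuaternionGroup n)) * {a i, xa j, xa k}) =
      #{i + i, (n : ZMod (2 * n)), n + j - k, n + k - j} + #{j - i, k - i, j + i, k + i} := by
  rw [← card_image_a_union_image_xa]
  congr 1
  ext (x | x) <;> simp [mem_mul, eq_comm] <;> grind

theorem card_div_axx (i j k : ZMod (2 * n)) :
    #(({a i, xa j, xa k} : Finset (QuaternionGroup n)) / {a i, xa j, xa k}) =
      #{0, j - k, k - j} + #{n + j - i, n + k - i, j - i, k - i} := by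
  have := two_mul_natCast_self (n := n)
  rw [← card_image_a_union_image_xa]
  congr 1
  ext (x | x) <;> simp [mem_div, a_div_xa, xa_div_a, xa_div_xa, one_def, eq_comm, -a_zero] <;> grind

theorem card_mul_aaa (i j k : ZMod (2 * n)) :
    #(({a i, a j, a k} : Finset (QuaternionGroup n)) * {a i, a j, a k}) =
      #{i + i, j + j, k + k, i + j, i + k, j + k} := by
  rw [← card_image_of_injective (f := a) _ fun _ _ => a.inj]
  congr 1
  ext (x | x) <;> simp [mem_mul, eq_comm] <;> grind

theorem card_div_aaa (i j k : ZMod (2 * n)) :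
    #(({a i, a j, a k} : Finset (QuaternionGroup n)) / {a i, a j, a k}) =
      #{0, i - j, j - i, i - k, k - i, j - k, k - j} := by
  rw [← card_image_of_injective (f := a) _ fun _ _ => a.inj]
  congr 1
  ext (x | x) <;> simp [mem_div, a_div_a, one_def, eq_comm, -a_zero] <;> grind

theorem card_mul_eq_card_div_xa_xa_xa (i j k : ZMod (2 * n)) :
    #(({xa i, xa j, xa k} : Finset (QuaternionGroup n)) * {xa i, xa j, xa k}) =
      #(({xa i, xa j, xa k} : Finset (QuaternionGroup n)) / {xa i, xa j, xa k}) := by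
  rw [← card_image_of_injective (_ / _) (mul_right_injective (a (n : ZMod (2 * n))))]
  have h (x y : ZMod (2 * n)) : a (n : ZMod (2 * n)) * (xa x / xa y) = xa x * xa y := by
    rw [xa_div_xa, a_mul_a, xa_mul_xa, add_sub_assoc]
  congr 1
  ext z
  simp only [mem_mul, mem_div, mem_image, mem_insert, mem_singleton]
  constructor
  · rintro ⟨x, hx, y, hy, rfl⟩
    refine ⟨_, ⟨x, hx, y, hy, rfl⟩, ?_⟩
    rcases hx with rfl | rfl | rfl <;> rcases hy with rfl | rfl | rfl <;> exact h _ _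
  · rintro ⟨_, ⟨x, hx, y, hy, rfl⟩, rfl⟩
    refine ⟨x, hx, y, hy, ?_⟩
    rcases hx with rfl | rfl | rfl <;> rcases hy with rfl | rfl | rfl <;> exact (h _ _).symm

variable {R : Type*} [CommRing R] [DecidableEq R] {N : R}

theorem card_mul_card_div_compare_aax (hN : N + N = 0) (hodd : ∀ x : R, x + x ≠ N)
    (h2 : ∀ x : R, x + x = 0 → x = 0 ∨ x = N) (i j k : R) (hij : i ≠ j) :
    let S := #{i + i, j + j, i + j, N} + #{k - i, k - j, k + i, k + j}
    let D := #{0, i - j, j - i} + #{k - i, k - j, N + k - i, N + k - j}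
    (D < S ↔ i + i ≠ 0 ∧ j + j ≠ 0 ∧ i + j ≠ 0 ∧ i + j ≠ N) ∧
    (S < D ↔ i + i ≠ 0 ∧ i + j = 0) := by
  intro S D
  have h0 := hodd 0
  have h1 := hodd i
  have h1' := hodd j
  have h3 := h2 i
  have h3' := h2 j
  have h4 := h2 (i - j)
  by_cases hd : i - j = N
  · have hj : j = i + N := by grind
    have e1 : ({0, i - j, j - i} : Finset R) = {0, N} := by ext; grind
    have e2 : ({k - i, k - j, N + k - i, N + k - j} : Finset R) = {k - i, k - i + N} := by
      ext; grind
    have hD : D = 4 := by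
      simp only [D]
      rw [e1, e2, card_pair (by grind), card_pair (by grind)]
    by_cases hi : i + i = 0
    · have e3 : ({i + i, j + j, i + j, N} : Finset R) = {0, N} := by ext; grind
      have e4 : ({k - i, k - j, k + i, k + j} : Finset R) = {k - i, k - i + N} := by ext; grind
      have hS : S = 4 := by
        simp only [S]
        rw [e3, e4, card_pair (by grind), card_pair (by grind)]
      grind
    · have e3 : ({i + i, j + j, i + j, N} : Finset R) = {i + i, i + i + N, N} := by ext; grind
      have hS : S = 7 := by
        simp only [S]
        have h6 := h2 (i + i)
        have h5 := hodd (i + i)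
        rw [e3, card_triple (by grind) (by grind) (by grind), card_quadruple (by grind) (by grind)
            (by grind) (card_triple (by grind) (by grind) (by grind))]
      grind
  · have hD : D = 7 := by
      simp only [D]
      rw [card_triple (by grind) (by grind) (by grind), card_quadruple (by grind) (by grind)
          (by grind) (card_triple (by grind) (by grind) (by grind))]
    by_cases hs : i + j = N
    · have e3 : ({i + i, j + j, i + j, N} : Finset R) = {i + i, j + j, N} := by ext; grind
      have hS : S = 7 := by
        simp only [S]
        rw [e3, card_triple (by grind) (by grind) (by grind), card_quadruple (by grind) (by grind)
            (by grind) (card_triple (by grind) (by grind) (by grind))]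
      grind
    have hS : S = 4 + #{k - i, k - j, k + i, k + j} := by
      simp only [S]
      rw [card_quadruple (by grind) (by grind) (by grind)
          (card_triple (by grind) (by grind) (by grind))]
    by_cases hs : i + j = 0
    · have e4 : ({k - i, k - j, k + i, k + j} : Finset R) = {k - i, k + i} := by ext; grind
      rw [e4, card_pair (by grind)] at hS
      grind
    by_cases hi : i + i = 0
    · have e4 : ({k - i, k - j, k + i, k + j} : Finset R) = {k - i, k - j, k + j} := by ext; grind
      rw [e4, card_triple (by grind) (by grind) (by grind)] at hS
      grind
    by_cases hj : j + j = 0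
    · have e4 : ({k - i, k - j, k + i, k + j} : Finset R) = {k - i, k - j, k + i} := by ext; grind
      rw [e4, card_triple (by grind) (by grind) (by grind)] at hS
      grind
    rw [card_quadruple (by grind) (by grind) (by grind)
        (card_triple (by grind) (by grind) (by grind))] at hS
    grind

theorem card_mul_card_div_compare_axx (hN : N + N = 0) (hodd : ∀ x : R, x + x ≠ N)
    (h2 : ∀ x : R, x + x = 0 → x = 0 ∨ x = N) (i j k : R) (hij : j ≠ k) :
    let S := #{i + i, N, N + j - k, N + k - j} + #{j - i, k - i, j + i, k + i}
    let D := #{0, j - k, k - j} + #{N + j - i, N + k - i, j - i, k - i}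
    (D < S ↔ i + i ≠ 0 ∧ i + i ≠ j - k ∧ i + i ≠ k - j ∧ i + i ≠ N + j - k ∧ i + i ≠ N + k - j) ∧
    (S < D ↔ i + i = 0 ∧ j - k ≠ N) := by
  intro S D
  have h0 := hodd 0
  have h1 := hodd i
  have h3 := h2 i
  have h4 := h2 (j - k)
  have h4' := hodd (j - k)
  have h4'' := hodd (k - j)
  by_cases hd : j - k = N
  · have hj : j = k + N := by grind
    have e1 : ({0, j - k, k - j} : Finset R) = {0, N} := by ext; grind
    have e2 : ({N + j - i, N + k - i, j - i, k - i} : Finset R) = {k - i, k - i + N} := by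
      ext; grind
    have e3 : ({i + i, N, N + j - k, N + k - j} : Finset R) = {i + i, N, 0} := by ext; grind
    have hD : D = 4 := by
      simp only [D]
      rw [e1, e2, card_pair (by grind), card_pair (by grind)]
    by_cases hi : i + i = 0
    · have e4 : ({j - i, k - i, j + i, k + i} : Finset R) = {k - i, k - i + N} := by ext; grind
      have e5 : ({i + i, N, 0} : Finset R) = {N, 0} := by ext; grind
      have hS : S = 4 := by
        simp only [S]
        rw [e3, e4, e5, card_pair (by grind), card_pair (by grind)]
      grind
    · have hS : S = 7 := by
        simp only [S]
        rw [e3, card_triple (by grind) (by grind) (by grind), card_quadruple (by grind) (by grind)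
            (by grind) (card_triple (by grind) (by grind) (by grind))]
      grind
  · have hD : D = 7 := by
      simp only [D]
      rw [card_triple (by grind) (by grind) (by grind), card_quadruple (by grind) (by grind)
          (by grind) (card_triple (by grind) (by grind) (by grind))]
    by_cases hs : i + i = N + j - k ∨ i + i = N + k - j
    · have e3 : ({i + i, N, N + j - k, N + k - j} : Finset R) = {N, N + j - k, N + k - j} := by
        ext; grind
      have hS : S = 7 := by
        simp only [S]
        rw [e3, card_triple (by grind) (by grind) (by grind), card_quadruple (by grind) (by grind)
            (by grind) (card_triple (by grind) (by grind) (by grind))]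
      grind
    have hS : S = 4 + #{j - i, k - i, j + i, k + i} := by
      simp only [S]
      rw [card_quadruple (by grind) (by grind) (by grind)
          (card_triple (by grind) (by grind) (by grind))]
    by_cases hi : i + i = 0
    · have e4 : ({j - i, k - i, j + i, k + i} : Finset R) = {j - i, k - i} := by ext; grind
      rw [e4, card_pair (by grind)] at hS
      grind
    by_cases hi : i + i = j - k
    · have e4 : ({j - i, k - i, j + i, k + i} : Finset R) = {j + i, j - i, k - i} := by ext; grind
      rw [e4, card_triple (by grind) (by grind) (by grind)] at hS
      grind
    by_cases hi : i + i = k - j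
    · have e4 : ({j - i, k - i, j + i, k + i} : Finset R) = {j - i, k - i, k + i} := by ext; grind
      rw [e4, card_triple (by grind) (by grind) (by grind)] at hS
      grind
    rw [card_quadruple (by grind) (by grind) (by grind)
        (card_triple (by grind) (by grind) (by grind))] at hS
    grind

theorem card_add_eq_card_sub (i j k : R) (h : i + k = j + j) :
    #{i + i, j + j, k + k, i + j, i + k, j + k} =
      #{0, i - j, j - i, i - k, k - i, j - k, k - j} := by
  rw [← card_image_of_injective ({0, i - j, j - i, i - k, k - i, j - k, k - j} : Finset R)
    (add_right_injective (j + j))]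
  congr 1
  obtain rfl : k = j + j - i := by grind
  ext y
  simp
  grind

theorem card_add_lt_card_sub_of_sub_eq (hN : N + N = 0) (hodd : ∀ x : R, x + x ≠ N)
    (h2 : ∀ x : R, x + x = 0 → x = 0 ∨ x = N) (i j k : R) (hij : i ≠ j) (hik : i ≠ k) (hjk : j ≠ k)
    (h : j - i = N) :
    #{i + i, j + j, k + k, i + j, i + k, j + k} <
      #{0, i - j, j - i, i - k, k - i, j - k, k - j} := by
  have h0 := hodd 0
  have h3 := h2 (k - i)
  have h4 := hodd (k - i)
  have h4' := hodd (i - k)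
  have e1 : ({i + i, j + j, k + k, i + j, i + k, j + k} : Finset R) =
      {i + i, k + k, i + j, i + k, j + k} := by ext; grind
  have e2 : ({0, i - j, j - i, i - k, k - i, j - k, k - j} : Finset R) =
      {0, N, i - k, k - i, N + i - k, N + k - i} := by ext; grind
  have hne : i - k ≠ k - i := fun h' => by
    rcases h3 (by linear_combination -h') with h5 | h5 <;> grind
  have hne' : N + i - k ≠ N + k - i := fun h' => hne (by linear_combination h')
  have hD : #({0, N, i - k, k - i, N + i - k, N + k - i} : Finset R) = 6 := by
    exact card_insert_of_card
      (by simp only [mem_insert, mem_singleton, not_or]; refine ⟨?_, ?_, ?_, ?_, ?_⟩ <;> grind)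
      (card_insert_of_card
      (by simp only [mem_insert, mem_singleton, not_or]; refine ⟨?_, ?_, ?_, ?_⟩ <;> grind)
      (card_quadruple hne (by grind) (by grind) (card_triple (by grind) (by grind) hne')))
  rw [e1, e2, hD]
  exact Nat.lt_succ_of_le card_le_five

theorem card_add_lt_card_sub (hN : N + N = 0) (hodd : ∀ x : R, x + x ≠ N)
    (h2 : ∀ x : R, x + x = 0 → x = 0 ∨ x = N) (i j k : R) (hij : i ≠ j) (hik : i ≠ k) (hjk : j ≠ k)
    (h : ¬ (i + k = j + j ∨ i + j = k + k ∨ j + k = i + i)) :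
    #{i + i, j + j, k + k, i + j, i + k, j + k} <
      #{0, i - j, j - i, i - k, k - i, j - k, k - j} := by
  have h0 := hodd 0
  by_cases hij' : j - i = N
  · exact card_add_lt_card_sub_of_sub_eq hN hodd h2 i j k hij hik hjk hij'
  by_cases hik' : k - i = N
  · convert card_add_lt_card_sub_of_sub_eq hN hodd h2 i k j hik hij hjk.symm hik' using 2 <;>
      ext <;> grind
  by_cases hjk' : k - j = N
  · convert card_add_lt_card_sub_of_sub_eq hN hodd h2 j k i hjk hij.symm hik.symm hjk' using 2 <;>
      ext <;> grind
  have h3 := h2 (k - i)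
  have h4 := h2 (j - i)
  have h5 := h2 (k - j)
  have hD : #({0, i - j, j - i, i - k, k - i, j - k, k - j} : Finset R) = 7 := by
    exact card_insert_of_card
      (by simp only [mem_insert, mem_singleton, not_or]; refine ⟨?_, ?_, ?_, ?_, ?_, ?_⟩ <;> grind)
      (card_insert_of_card
      (by simp only [mem_insert, mem_singleton, not_or]; refine ⟨?_, ?_, ?_, ?_, ?_⟩ <;> grind)
      (card_insert_of_card
      (by simp only [mem_insert, mem_singleton, not_or]; refine ⟨?_, ?_, ?_, ?_⟩ <;> grind)
      (card_quadruple (by grind) (by grind) (by grind)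
          (card_triple (by grind) (by grind) (by grind)))))
  rw [hD]
  exact Nat.lt_succ_of_le card_le_six

theorem card_mul_card_div_compare_aaa (hN : N + N = 0) (hodd : ∀ x : R, x + x ≠ N)
    (h2 : ∀ x : R, x + x = 0 → x = 0 ∨ x = N) (i j k : R) (hij : i ≠ j) (hik : i ≠ k)
        (hjk : j ≠ k) :
    let S := #{i + i, j + j, k + k, i + j, i + k, j + k}
    let D := #{0, i - j, j - i, i - k, k - i, j - k, k - j}
    ¬ D < S ∧ (S < D ↔ ¬ (i + k = j + j ∨ i + j = k + k ∨ j + k = i + i)) := by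
  intro S D
  by_cases h : (i + k = j + j ∨ i + j = k + k ∨ j + k = i + i)
  · have : S = D := by
      simp only [S, D]
      rcases h with h | h | h
      · exact card_add_eq_card_sub i j k h
      · convert card_add_eq_card_sub i k j h using 2 <;> ext <;> grind
      · convert card_add_eq_card_sub j i k h using 2 <;> ext <;> grind
    grind
  · have := card_add_lt_card_sub hN hodd h2 i j k hij hik hjk h
    grind

end QuaternionGroup

section Counting

variable {G : Type*} [Fintype G] [DecidableEq G]

theorem card_filter_ordered_triples_eq_six {A : Finset G} (hA : #A = 3) :
    #{t : G × G × G | (t.1 ≠ t.2.1 ∧ t.1 ≠ t.2.2 ∧ t.2.1 ≠ t.2.2) ∧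
      ({t.1, t.2.1, t.2.2} : Finset G) = A} = 6 := by
  obtain ⟨x, y, z, hxy, hxz, hyz, rfl⟩ := card_eq_three.mp hA
  have : ({t : G × G × G | (t.1 ≠ t.2.1 ∧ t.1 ≠ t.2.2 ∧ t.2.1 ≠ t.2.2) ∧
      ({t.1, t.2.1, t.2.2} : Finset G) = {x, y, z}} : Finset _) =
      {(x, y, z), (x, z, y), (y, x, z), (y, z, x), (z, x, y), (z, y, x)} := by
    ext ⟨u, v, w⟩
    simp only [mem_filter, mem_univ, true_and, mem_insert, mem_singleton, Prod.mk.injEq]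
    constructor
    · rintro ⟨⟨huv, huw, hvw⟩, h⟩
      have hu : u ∈ ({x, y, z} : Finset G) := h ▸ by simp
      have hv : v ∈ ({x, y, z} : Finset G) := h ▸ by simp
      have hw : w ∈ ({x, y, z} : Finset G) := h ▸ by simp
      simp only [mem_insert, mem_singleton] at hu hv hw
      clear h
      grind
    · rintro (⟨rfl, rfl, rfl⟩ | ⟨rfl, rfl, rfl⟩ | ⟨rfl, rfl, rfl⟩ | ⟨rfl, rfl, rfl⟩ |
        ⟨rfl, rfl, rfl⟩ | ⟨rfl, rfl, rfl⟩) <;>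
      refine ⟨by tauto, ?_⟩ <;> ext <;> simp only [mem_insert, mem_singleton] <;> tauto
  rw [this]
  simp [card_insert_of_notMem, hxy, hxz, hyz, hxy.symm, hxz.symm, hyz.symm]

open Classical in
theorem six_mul_ncard_eq_sum (P : Finset G → Prop) :
    (6 * {A : Finset G | #A = 3 ∧ P A}.ncard : ℤ) =
      ∑ x : G, ∑ y : G, ∑ z : G,
        if (x ≠ y ∧ x ≠ z ∧ y ≠ z) ∧ P {x, y, z} then 1 else 0 := by
  have h1 : {A : Finset G | #A = 3 ∧ P A} = ({A | #A = 3 ∧ P A} : Finset (Finset G)) := by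
    ext; simp
  rw [h1, Set.ncard_coe_finset]
  have h2 := card_eq_sum_card_fiberwise
    (s := ({t : G × G × G | (t.1 ≠ t.2.1 ∧ t.1 ≠ t.2.2 ∧ t.2.1 ≠ t.2.2) ∧
      P {t.1, t.2.1, t.2.2}} : Finset _))
    (t := ({A | #A = 3 ∧ P A} : Finset (Finset G))) (f := fun t => {t.1, t.2.1, t.2.2})
    (by
      rintro ⟨x, y, z⟩ h
      simp only [coe_filter, mem_univ, true_and, Set.mem_ofPred_eq] at h ⊢
      exact ⟨card_eq_three.mpr ⟨x, y, z, h.1.1, h.1.2.1, h.1.2.2, rfl⟩, h.2⟩)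
  rw [sum_congr rfl (g := fun _ => 6), sum_const, smul_eq_mul] at h2
  · rw [mul_comm]
    have h3 : ((#{A : Finset G | #A = 3 ∧ P A} : ℤ) * 6) =
        ((#{A : Finset G | #A = 3 ∧ P A} * 6 : ℕ) : ℤ) := by
      push_cast; rfl
    rw [h3, ← h2, ← sum_boole, Fintype.sum_prod_type]
    simp_rw [Fintype.sum_prod_type]
  · intro A hA
    simp only [mem_filter, mem_univ, true_and] at hA
    rw [← card_filter_ordered_triples_eq_six hA.1, filter_filter]
    congr 1
    ext t
    simp only [mem_filter, mem_univ, true_and]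
    constructor
    · rintro ⟨⟨h, -⟩, h'⟩
      exact ⟨h, h'⟩
    · rintro ⟨h, rfl⟩
      exact ⟨⟨h, hA.2⟩, rfl⟩

theorem sum_ite_notMem (s : Finset G) (c : ℤ) (p : G → Prop) [DecidablePred p]
    (hp : ∀ x, p x ↔ x ∉ s) :
    ∑ x, (if p x then c else 0) = (Fintype.card G - #s) * c := by
  simp_rw [hp]
  rw [← sum_filter, sum_const, nsmul_eq_mul, show ({x | x ∉ s} : Finset G) = sᶜ by ext; simp,
    card_compl, Nat.cast_sub (card_le_univ s)]

theorem sum_ite_eq_of_iff (g : G) (q : Prop) [Decidable q] (p : G → Prop) [DecidablePred p]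
    (hp : ∀ x, p x ↔ x = g ∧ q) : ∑ x, (if p x then 1 else 0 : ℤ) = if q then 1 else 0 := by
  simp_rw [hp, ite_and]
  simp

end Counting

namespace QuaternionGroup

variable {n : ℕ}

theorem sum_eq_sum_a_add_sum_xa [NeZero n] (f : QuaternionGroup n → ℤ) :
    ∑ x, f x = ∑ i, f (a i) + ∑ i, f (xa i) := by
  let e : ZMod (2 * n) ⊕ ZMod (2 * n) ≃ QuaternionGroup n :=
    { toFun := Sum.elim a xa
      invFun := fun | a i => .inl i | xa i => .inr i
      left_inv := by rintro (i | i) <;> rfl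
      right_inv := by rintro (i | i) <;> rfl }
  rw [← e.sum_comp, Fintype.sum_sum_type]
  rfl

theorem sum_triple_of_symmetric [NeZero n]
    (f : QuaternionGroup n → QuaternionGroup n → QuaternionGroup n → ℤ)
    (h₁ : ∀ x y z, f x y z = f y x z) (h₂ : ∀ x y z, f x y z = f x z y) :
    ∑ x, ∑ y, ∑ z, f x y z =
      (∑ i, ∑ j, ∑ k, f (a i) (a j) (a k)) + 3 * (∑ i, ∑ j, ∑ k, f (a i) (a j) (xa k)) +
      3 * (∑ i, ∑ j, ∑ k, f (a i) (xa j) (xa k)) + ∑ i, ∑ j, ∑ k, f (xa i) (xa j) (xa k) := by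
  simp only [sum_eq_sum_a_add_sum_xa, sum_add_distrib]
  have e1 : ∑ i, ∑ j, ∑ k, f (a i) (xa j) (a k) = ∑ i, ∑ j, ∑ k, f (a i) (a j) (xa k) := by
    refine sum_congr rfl fun i _ => ?_
    rw [sum_comm]
    simp_rw [h₂ _ (xa _) (a _)]
  have e2 : ∑ i, ∑ j, ∑ k, f (xa i) (a j) (a k) = ∑ i, ∑ j, ∑ k, f (a i) (a j) (xa k) := by
    rw [← e1, sum_comm]
    simp_rw [h₁ (xa _) (a _)]
  have e3 : ∑ i, ∑ j, ∑ k, f (xa i) (a j) (xa k) = ∑ i, ∑ j, ∑ k, f (a i) (xa j) (xa k) := by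
    rw [sum_comm]
    simp_rw [h₁ (xa _) (a _)]
  have e4 : ∑ i, ∑ j, ∑ k, f (xa i) (xa j) (a k) = ∑ i, ∑ j, ∑ k, f (a i) (xa j) (xa k) := by
    rw [← e3]
    refine sum_congr rfl fun i _ => ?_
    rw [sum_comm]
    simp_rw [h₂ _ (xa _) (a _)]
  rw [e1, e2, e3, e4]
  ring

section
variable {R : Type*} [CommRing R] [Fintype R] [DecidableEq R] {N : R}

theorem sum_ite_add_self_ne_zero (hN : N + N = 0) (hodd : ∀ x : R, x + x ≠ N)
    (h2 : ∀ x : R, x + x = 0 → x = 0 ∨ x = N) (i : R) (c : ℤ) :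
    ∑ j, (if (j - i) + (j - i) ≠ 0 then c else 0) = (Fintype.card R - 2) * c := by
  have h0 := hodd 0
  rw [sum_ite_notMem {i, i + N}, card_pair (by grind)]
  · simp
  intro x
  have := h2 (x - i)
  simp only [mem_insert, mem_singleton]
  grind

theorem sum_ite_mstd_aax (hN : N + N = 0) (hodd : ∀ x : R, x + x ≠ N)
    (h2 : ∀ x : R, x + x = 0 → x = 0 ∨ x = N) :
    ∑ i : R, ∑ j : R, ∑ _k : R, (if i ≠ j ∧ i + i ≠ 0 ∧ j + j ≠ 0 ∧ i + j ≠ 0 ∧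
        i + j ≠ N then 1 else 0 : ℤ) =
      Fintype.card R * (Fintype.card R - 2) * (Fintype.card R - 5) := by
  have h0 := hodd 0
  have h (i : R) : ∑ j : R, (if i ≠ j ∧ i + i ≠ 0 ∧ j + j ≠ 0 ∧ i + j ≠ 0 ∧
      i + j ≠ N then 1 else 0 : ℤ) =
      if (i - 0) + (i - 0) ≠ 0 then (Fintype.card R - 5 : ℤ) else 0 := by
    split_ifs with hi
    · have := hodd i
      have := hodd (-i)
      have := h2 i
      rw [sum_ite_notMem {i, 0, N, -i, N - i}, card_insert_of_card (m := 4)]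
      · simp
      · simp only [mem_insert, mem_singleton, not_or]; refine ⟨?_, ?_, ?_, ?_⟩ <;> grind
      · exact (card_quadruple (by grind) (by grind) (by grind)
          (card_triple (by grind) (by grind) (by grind)))
      · intro j
        have := h2 j
        simp only [mem_insert, mem_singleton, not_or]
        grind
    · refine sum_eq_zero fun j _ => if_neg ?_
      grind
  simp only [sum_const, card_univ, nsmul_eq_mul, ← mul_sum, h, sum_ite_add_self_ne_zero hN hodd h2]
  ring

theorem sum_ite_mdts_aax (hN : N + N = 0) (hodd : ∀ x : R, x + x ≠ N)
    (h2 : ∀ x : R, x + x = 0 → x = 0 ∨ x = N) :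
    ∑ i : R, ∑ j : R, ∑ _k : R, (if i ≠ j ∧ i + i ≠ 0 ∧ i + j = 0 then 1 else 0 : ℤ) =
      Fintype.card R * (Fintype.card R - 2) := by
  have h (i : R) : ∑ j : R, (if i ≠ j ∧ i + i ≠ 0 ∧ i + j = 0 then 1 else 0 : ℤ) =
      if (i - 0) + (i - 0) ≠ 0 then 1 else 0 := by
    apply sum_ite_eq_of_iff (-i)
    grind
  simp only [sum_const, card_univ, nsmul_eq_mul, ← mul_sum, h, sum_ite_add_self_ne_zero hN hodd h2]
  ring

theorem sum_ite_mstd_axx (hN : N + N = 0) (hodd : ∀ x : R, x + x ≠ N)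
    (h2 : ∀ x : R, x + x = 0 → x = 0 ∨ x = N) :
    ∑ i : R, ∑ j : R, ∑ k : R, (if j ≠ k ∧ i + i ≠ 0 ∧ i + i ≠ j - k ∧ i + i ≠ k - j ∧
        i + i ≠ N + j - k ∧ i + i ≠ N + k - j then 1 else 0 : ℤ) =
      Fintype.card R * (Fintype.card R - 2) * (Fintype.card R - 5) := by
  have h0 := hodd 0
  have h (i j : R) : ∑ k : R, (if j ≠ k ∧ i + i ≠ 0 ∧ i + i ≠ j - k ∧ i + i ≠ k - j ∧
      i + i ≠ N + j - k ∧ i + i ≠ N + k - j then 1 else 0 : ℤ) =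
      if (i - 0) + (i - 0) ≠ 0 then (Fintype.card R - 5 : ℤ) else 0 := by
    split_ifs with hi
    · have := hodd i
      have := hodd (-i)
      have := h2 i
      have := h2 (i + i)
      have := hodd (i + i)
      have := hodd (-(i + i))
      rw [sum_ite_notMem {j, j - (i + i), j + (i + i), N + j - (i + i), N + j + (i + i)},
          card_insert_of_card (m := 4)]
      · simp
      · simp only [mem_insert, mem_singleton, not_or]; refine ⟨?_, ?_, ?_, ?_⟩ <;> grind
      · exact (card_quadruple (by grind) (by grind) (by grind)
          (card_triple (by grind) (by grind) (by grind)))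
      · intro k
        simp only [mem_insert, mem_singleton, not_or]
        grind
    · refine sum_eq_zero fun j _ => if_neg ?_
      grind
  simp only [h, sum_const, card_univ, nsmul_eq_mul, ← mul_sum, sum_ite_add_self_ne_zero hN hodd h2]
  ring

theorem sum_ite_mdts_axx (hN : N + N = 0) (hodd : ∀ x : R, x + x ≠ N)
    (h2 : ∀ x : R, x + x = 0 → x = 0 ∨ x = N) :
    ∑ i : R, ∑ j : R, ∑ k : R, (if j ≠ k ∧ i + i = 0 ∧ j - k ≠ N then 1 else 0 : ℤ) =
      2 * Fintype.card R * (Fintype.card R - 2) := by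
  have h0 := hodd 0
  have h (i j : R) : ∑ k : R, (if j ≠ k ∧ i + i = 0 ∧ j - k ≠ N then 1 else 0 : ℤ) =
      (Fintype.card R - 2) - if (i - 0) + (i - 0) ≠ 0 then (Fintype.card R - 2 : ℤ) else 0 := by
    split_ifs with hi
    · rw [sub_self]
      refine sum_eq_zero fun j _ => if_neg ?_
      grind
    · rw [sum_ite_notMem {j, j + N}, card_pair (by grind)]
      · simp
      · intro k
        simp only [mem_insert, mem_singleton, not_or]
        grind
  simp only [h, sum_sub_distrib, sum_const, card_univ, nsmul_eq_mul, ← mul_sum,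
      sum_ite_add_self_ne_zero hN hodd h2]
  ring

theorem sum_ite_mdts_aaa (hN : N + N = 0) (hodd : ∀ x : R, x + x ≠ N)
    (h2 : ∀ x : R, x + x = 0 → x = 0 ∨ x = N)
    (h3 : #{x : R | 3 * x = 0} = 3) :
    ∑ i : R, ∑ j : R, ∑ k : R, (if (i ≠ j ∧ i ≠ k ∧ j ≠ k) ∧
        ¬ (i + k = j + j ∨ i + j = k + k ∨ j + k = i + i) then 1 else 0 : ℤ) =
      Fintype.card R * ((Fintype.card R) ^ 2 - 6 * Fintype.card R + 12) := by
  have h0 := hodd 0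
  let M : ℤ := Fintype.card R
  have hd (i : R) : ∑ j : R, ∑ k : R, (if i ≠ j ∧ i ≠ k ∧ j ≠ k then 1 else 0 : ℤ) =
      (M - 1) * (M - 2) := by
    have h (j : R) : ∑ k : R, (if i ≠ j ∧ i ≠ k ∧ j ≠ k then 1 else 0 : ℤ) =
        if i ≠ j then M - 2 else 0 := by
      split_ifs with hij
      · rw [sum_ite_notMem {i, j}, card_pair hij]
        · simp [M]
        · intro k
          simp only [mem_insert, mem_singleton, not_or]
          grind
      · refine sum_eq_zero fun j _ => if_neg ?_
        grind
    simp_rw [h]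
    rw [sum_ite_notMem {i} _ _ (by simp [eq_comm])]
    simp [M]
  have e1 (i : R) : ∑ j : R, ∑ k : R,
      (if (i ≠ j ∧ i ≠ k ∧ j ≠ k) ∧ i + k = j + j then 1 else 0 : ℤ) = M - 2 := by
    have h (j : R) : ∑ k : R, (if (i ≠ j ∧ i ≠ k ∧ j ≠ k) ∧ i + k = j + j then 1 else 0 : ℤ) =
        if (j - i) + (j - i) ≠ 0 then 1 else 0 := by
      apply sum_ite_eq_of_iff (j + j - i)
      grind
    simp_rw [h, sum_ite_add_self_ne_zero hN hodd h2, mul_one]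
    rfl
  have e2 (i : R) : ∑ j : R, ∑ k : R,
      (if (i ≠ j ∧ i ≠ k ∧ j ≠ k) ∧ i + j = k + k then 1 else 0 : ℤ) = M - 2 := by
    rw [← e1 i, sum_comm]
    refine sum_congr rfl fun j _ => sum_congr rfl fun k _ => if_congr ?_ rfl rfl
    grind
  have e3 (i : R) : ∑ j : R, ∑ k : R,
      (if (i ≠ j ∧ i ≠ k ∧ j ≠ k) ∧ j + k = i + i then 1 else 0 : ℤ) = M - 2 := by
    have h (j : R) : ∑ k : R, (if (i ≠ j ∧ i ≠ k ∧ j ≠ k) ∧ j + k = i + i then 1 else 0 : ℤ) =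
        if (j - i) + (j - i) ≠ 0 then 1 else 0 := by
      apply sum_ite_eq_of_iff (i + i - j)
      grind
    simp_rw [h, sum_ite_add_self_ne_zero hN hodd h2, mul_one]
    rfl
  have e4 (i : R) : ∑ j : R, ∑ k : R,
      (if (i ≠ j ∧ i ≠ k ∧ j ≠ k) ∧ i + k = j + j ∧ i + j = k + k then 1 else 0 : ℤ) = 2 := by
    have h (j : R) : ∑ k : R,
        (if (i ≠ j ∧ i ≠ k ∧ j ≠ k) ∧ i + k = j + j ∧ i + j = k + k then 1 else 0 : ℤ) =
        if j - i ≠ 0 ∧ 3 * (j - i) = 0 then 1 else 0 := by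
      apply sum_ite_eq_of_iff (j + j - i)
      intro k
      constructor
      · rintro ⟨⟨hij, -, -⟩, c1, c2⟩
        exact ⟨by linear_combination c1, sub_ne_zero.mpr hij.symm,
          by linear_combination -c2 - 2 * c1⟩
      · rintro ⟨rfl, hij, c⟩
        refine ⟨⟨fun h => hij ?_, fun h => hij ?_, fun h => hij ?_⟩, by ring, ?_⟩
        · linear_combination -h
        · linear_combination c + h
        · linear_combination -h
        · linear_combination -c
    simp_rw [h]
    refine ((Equiv.subRight i).sum_comp
      (fun x : R => if x ≠ 0 ∧ 3 * x = 0 then (1 : ℤ) else 0)).trans ?_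
    rw [sum_boole]
    have : ({x : R | x ≠ 0 ∧ 3 * x = 0} : Finset R) = ({x : R | 3 * x = 0} : Finset R).erase 0 := by
      ext; simp
    rw [this, card_erase_of_mem (by simp), h3]
    rfl
  have key (i j k : R) :
      (if (i ≠ j ∧ i ≠ k ∧ j ≠ k) ∧ ¬ (i + k = j + j ∨ i + j = k + k ∨ j + k = i + i)
        then 1 else 0 : ℤ) =
      (if i ≠ j ∧ i ≠ k ∧ j ≠ k then 1 else 0) -
      (if (i ≠ j ∧ i ≠ k ∧ j ≠ k) ∧ i + k = j + j then 1 else 0) -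
      (if (i ≠ j ∧ i ≠ k ∧ j ≠ k) ∧ i + j = k + k then 1 else 0) -
      (if (i ≠ j ∧ i ≠ k ∧ j ≠ k) ∧ j + k = i + i then 1 else 0) +
      2 * (if (i ≠ j ∧ i ≠ k ∧ j ≠ k) ∧ i + k = j + j ∧ i + j = k + k then 1 else 0) := by
    by_cases hdist : i ≠ j ∧ i ≠ k ∧ j ≠ k
    swap
    · simp only [hdist, false_and, if_false]; rfl
    simp only [hdist, true_and, ne_eq, not_false_eq_true, and_self, if_true]
    by_cases c1 : i + k = j + j <;> by_cases c2 : i + j = k + k <;> by_cases c3 : j + k = i + i <;>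
      simp only [c1, c2, c3] <;> first | rfl | (exfalso; grind)
  simp_rw [key, sum_add_distrib, sum_sub_distrib, ← mul_sum, hd, e1, e2, e3, e4]
  simp only [sum_const, card_univ, nsmul_eq_mul]
  simp only [M]
  ring

end

end QuaternionGroup

namespace QuaternionGroup

variable {n : ℕ}

theorem six_mul_ncard [NeZero n] (P : Finset (QuaternionGroup n) → Prop)
    (p q r s : ZMod (2 * n) → ZMod (2 * n) → ZMod (2 * n) → Prop)
    [∀ i j k, Decidable (p i j k)] [∀ i j k, Decidable (q i j k)]
    [∀ i j k, Decidable (r i j k)] [∀ i j k, Decidable (s i j k)]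
    (hp : ∀ i j k, (i ≠ j ∧ i ≠ k ∧ j ≠ k) ∧ P {a i, a j, a k} ↔ p i j k)
    (hq : ∀ i j k, i ≠ j ∧ P {a i, a j, xa k} ↔ q i j k)
    (hr : ∀ i j k, j ≠ k ∧ P {a i, xa j, xa k} ↔ r i j k)
    (hs : ∀ i j k, (i ≠ j ∧ i ≠ k ∧ j ≠ k) ∧ P {xa i, xa j, xa k} ↔ s i j k) :
    (6 * {A : Finset (QuaternionGroup n) | #A = 3 ∧ P A}.ncard : ℤ) =
      (∑ i, ∑ j, ∑ k, if p i j k then 1 else 0) + 3 * (∑ i, ∑ j, ∑ k, if q i j k then 1 else 0) +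
      3 * (∑ i, ∑ j, ∑ k, if r i j k then 1 else 0) + ∑ i, ∑ j, ∑ k, if s i j k then 1 else 0 := by
  classical
  let f (x y z : QuaternionGroup n) : ℤ := if (x ≠ y ∧ x ≠ z ∧ y ≠ z) ∧ P {x, y, z} then 1 else 0
  have f_swap_left (x y z) : f x y z = f y x z :=
    if_congr (by rw [insert_comm, ne_comm (a := y)]; tauto) rfl rfl
  have f_swap_right (x y z) : f x y z = f x z y :=
    if_congr (by rw [pair_comm, ne_comm (a := z)]; tauto) rfl rfl
  have hf := sum_triple_of_symmetric f f_swap_left f_swap_right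
  have ep (i j k) : f (a i) (a j) (a k) = if p i j k then 1 else 0 :=
    if_congr (by simp [← hp]) rfl rfl
  have eq (i j k) : f (a i) (a j) (xa k) = if q i j k then 1 else 0 :=
    if_congr (by simp [← hq]) rfl rfl
  have er (i j k) : f (a i) (xa j) (xa k) = if r i j k then 1 else 0 :=
    if_congr (by simp [← hr]) rfl rfl
  have es (i j k) : f (xa i) (xa j) (xa k) = if s i j k then 1 else 0 :=
    if_congr (by simp [← hs]) rfl rfl
  simp only [ep, eq, er, es] at hf
  rw [six_mul_ncard_eq_sum, ← hf]

theorem six_mul_ncard_isMSTD [NeZero n] (hodd : Odd n) :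
    (6 * {A : Finset (QuaternionGroup n) | #A = 3 ∧ IsMSTD A}.ncard : ℤ) =
      6 * (2 * n * (2 * n - 2) * (2 * n - 5)) := by
  have hN := two_mul_natCast_self (n := n)
  have ho := add_self_ne_natCast hodd
  have h2 (x) := eq_zero_or_eq_natCast_of_add_self_eq_zero (NeZero.ne n) (x := x)
  rw [six_mul_ncard IsMSTD (fun _ _ _ => False)
    (fun i j _ => i ≠ j ∧ i + i ≠ 0 ∧ j + j ≠ 0 ∧ i + j ≠ 0 ∧ i + j ≠ (n : ZMod (2 * n)))
    (fun i j k => j ≠ k ∧ i + i ≠ 0 ∧ i + i ≠ j - k ∧ i + i ≠ k - j ∧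
      i + i ≠ (n : ZMod (2 * n)) + j - k ∧ i + i ≠ (n : ZMod (2 * n)) + k - j)
    (fun _ _ _ => False) ?_
    (fun i j k => and_congr_right fun h => ?_) (fun i j k => and_congr_right fun h => ?_) ?_,
    sum_ite_mstd_aax hN ho h2, sum_ite_mstd_axx hN ho h2]
  · simp
    ring
  · rintro i j k
    simp only [iff_false, not_and, IsMSTD, card_mul_aaa, card_div_aaa]
    exact fun h => (card_mul_card_div_compare_aaa hN ho h2 i j k h.1 h.2.1 h.2.2).1
  · simp [IsMSTD, card_mul_eq_card_div_xa_xa_xa]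
  · rw [IsMSTD, card_mul_aax, card_div_aax]
    exact (card_mul_card_div_compare_aax hN ho h2 i j k h).1
  · rw [IsMSTD, card_mul_axx, card_div_axx]
    exact (card_mul_card_div_compare_axx hN ho h2 i j k h).1

theorem six_mul_ncard_isMDTS [NeZero n] (hodd : Odd n) (hdvd : 3 ∣ n) :
    (6 * {A : Finset (QuaternionGroup n) | #A = 3 ∧ IsMDTS A}.ncard : ℤ) =
      4 * n * (2 * n ^ 2 + 3 * n - 3) := by
  have hN := two_mul_natCast_self (n := n)
  have ho := add_self_ne_natCast hodd
  have h2 (x) := eq_zero_or_eq_natCast_of_add_self_eq_zero (NeZero.ne n) (x := x)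
  rw [six_mul_ncard IsMDTS
    (fun i j k => (i ≠ j ∧ i ≠ k ∧ j ≠ k) ∧ ¬(i + k = j + j ∨ i + j = k + k ∨ j + k = i + i))
    (fun i j _ => i ≠ j ∧ i + i ≠ 0 ∧ i + j = 0)
    (fun i j k => j ≠ k ∧ i + i = 0 ∧ j - k ≠ (n : ZMod (2 * n)))
    (fun _ _ _ => False) (fun i j k => and_congr_right fun h => ?_)
    (fun i j k => and_congr_right fun h => ?_) (fun i j k => and_congr_right fun h => ?_) ?_,
    sum_ite_mdts_aaa hN ho h2 (card_filter_three_mul_eq_zero hdvd),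
    sum_ite_mdts_aax hN ho h2, sum_ite_mdts_axx hN ho h2]
  · simp
    ring
  · simp [IsMDTS, card_mul_eq_card_div_xa_xa_xa]
  · rw [IsMDTS, card_mul_aaa, card_div_aaa]
    exact (card_mul_card_div_compare_aaa hN ho h2 i j k h.1 h.2.1 h.2.2).2
  · rw [IsMDTS, card_mul_aax, card_div_aax]
    exact (card_mul_card_div_compare_aax hN ho h2 i j k h).2
  · rw [IsMDTS, card_mul_axx, card_div_axx]
    exact (card_mul_card_div_compare_axx hN ho h2 i j k h).2

theorem six_mul_ncard_add_ncard_add_ncard [NeZero n] :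
    (6 * ({A : Finset (QuaternionGroup n) | #A = 3 ∧ IsMSTD A}.ncard +
      {A : Finset (QuaternionGroup n) | #A = 3 ∧ IsMDTS A}.ncard +
      {A : Finset (QuaternionGroup n) | #A = 3 ∧ IsBalanced A}.ncard) : ℤ) =
      4 * n * (4 * n - 1) * (4 * n - 2) := by
  have h1 : {A : Finset (QuaternionGroup n) | #A = 3 ∧ IsMSTD A}.ncard +
      {A : Finset (QuaternionGroup n) | #A = 3 ∧ IsMDTS A}.ncard +
      {A : Finset (QuaternionGroup n) | #A = 3 ∧ IsBalanced A}.ncard = (4 * n).choose 3 := by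
    rw [← Set.ncard_union_eq, ← Set.ncard_union_eq, ← QuaternionGroup.card (n := n), ← card_univ,
      ← card_powersetCard, ← Set.ncard_coe_finset]
    · congr 1
      ext A
      simp only [Set.mem_union, Set.mem_ofPred_eq, mem_coe, mem_powersetCard, IsMSTD, IsMDTS,
          IsBalanced]
      have := lt_trichotomy (#(A * A)) (#(A / A))
      simp
      tauto
    all_goals
      rw [Set.disjoint_left]
      simp only [Set.mem_union, Set.mem_ofPred_eq, IsMSTD, IsMDTS, IsBalanced]
      grind
  have h2 := Nat.descFactorial_eq_factorial_mul_choose (4 * n) 3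
  obtain ⟨m, rfl⟩ := Nat.exists_eq_succ_of_ne_zero (NeZero.ne n)
  rw [show 4 * m.succ = 4 * m + 1 + 3 by omega] at h1 h2
  rw [← h1, Nat.add_descFactorial_eq_ascFactorial] at h2
  simp only [Nat.ascFactorial, Nat.factorial] at h2
  generalize {A : Finset (QuaternionGroup (m + 1)) | #A = 3 ∧ IsMSTD A}.ncard = S at *
  generalize {A : Finset (QuaternionGroup (m + 1)) | #A = 3 ∧ IsMDTS A}.ncard = D at *
  generalize {A : Finset (QuaternionGroup (m + 1)) | #A = 3 ∧ IsBalanced A}.ncard = B at *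
  zify at h2
  push_cast at h2 ⊢
  linear_combination -h2

end QuaternionGroup

theorem stmt_2 (n : ℕ) (hn : 3 ≤ n) (hodd : Odd n) (hdvd : 3 ∣ n) :
    {A : Finset (QuaternionGroup n) | A.card = 3 ∧ IsMSTD A}.ncard
        = 4 * n * (n - 1) * (2 * n - 5) ∧
    {A : Finset (QuaternionGroup n) | A.card = 3 ∧ IsMDTS A}.ncard
        = 2 * n * (2 * n ^ 2 + 3 * n - 3) / 3 ∧
    {A : Finset (QuaternionGroup n) | A.card = 3 ∧ IsBalanced A}.ncard
        = 2 * n * (2 * n ^ 2 + 27 * n - 25) / 3 := by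
  have : NeZero n := ⟨by omega⟩
  have hS := QuaternionGroup.six_mul_ncard_isMSTD hodd
  have hD := QuaternionGroup.six_mul_ncard_isMDTS hodd hdvd
  have hT := QuaternionGroup.six_mul_ncard_add_ncard_add_ncard (n := n)
  generalize {A : Finset (QuaternionGroup n) | #A = 3 ∧ IsMSTD A}.ncard = S at *
  generalize {A : Finset (QuaternionGroup n) | #A = 3 ∧ IsMDTS A}.ncard = D at *
  generalize {A : Finset (QuaternionGroup n) | #A = 3 ∧ IsBalanced A}.ncard = B at *
  have e1 : 1 ≤ n := by omega
  have e2 : 5 ≤ 2 * n := by omega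
  have e3 : 3 ≤ 2 * n ^ 2 + 3 * n := by nlinarith
  have e4 : 25 ≤ 2 * n ^ 2 + 27 * n := by nlinarith
  refine ⟨?_, (Nat.div_eq_of_eq_mul_right three_pos ?_).symm,
    (Nat.div_eq_of_eq_mul_right three_pos ?_).symm⟩
  · zify [e1, e2]
    linarith
  · zify [e3]
    linarith
  · zify [e4]
    linarith
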